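/- Volume mean-value formula for Helmholtz solutions: let k > 0, z ∈ ℝ³, r > 0, and let u : ℝ³ → ℂ be twice continuously differentiable on an open set containing the closed ball of center z and radius r, with Δu + k² u = 0 there. Then ∫_{B_r(z)} u(y) dy = (4π/k³) ( sin(kr) − kr·cos(kr) ) u(z), where the integral is with respect to Lebesgue measure on ℝ³. -/

import Mathlib

noncomputable section

abbrev E3 := EuclideanSpace ℝ (Fin 3)

/-- Partial derivative `∂ⱼ f` of a scalar-valued function on ℝ³. -/
def pd (j : Fin 3) (f : E3 → ℂ) (x : E3) : ℂ :=
  fderiv ℝ f x (EuclideanSpace.single j 1)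

/-- Componentwise Laplacian `Δf = Σⱼ ∂ⱼ∂ⱼ f` of a scalar-valued function. -/
def lap (f : E3 → ℂ) (x : E3) : ℂ := ∑ j, pd j (pd j f) x


open MeasureTheory
open Filter Topology Metric Set

theorem hasDerivAt_max_zero_pow (n : ℕ) (s : ℝ) :
    HasDerivAt (fun s : ℝ ↦ max s 0 ^ (n + 2)) ((n + 2) * max s 0 ^ (n + 1)) s := by
  rcases lt_trichotomy s 0 with hs | rfl | hs
  · rw [max_eq_right hs.le]
    have h : (fun s : ℝ ↦ max s 0 ^ (n + 2)) =ᶠ[𝓝 s] fun _ ↦ 0 := by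
      filter_upwards [Iio_mem_nhds hs] with x hx
      simp [max_eq_right (le_of_lt (mem_Iio.1 hx))]
    simpa using (hasDerivAt_const s (0 : ℝ)).congr_of_eventuallyEq h
  · rw [hasDerivAt_iff_isLittleO_nhds_zero]
    have h : (fun h : ℝ ↦ max h 0 ^ (n + 2)) =o[𝓝 0] fun h ↦ h := by
      have h1 : (fun h : ℝ ↦ max h 0) =O[𝓝 0] fun h ↦ h :=
        Asymptotics.IsBigO.of_bound 1 <| .of_forall fun x ↦ by
          rw [one_mul, Real.norm_of_nonneg (le_max_right _ _), Real.norm_eq_abs]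
          exact max_le (le_abs_self x) (abs_nonneg x)
      have h2 : (fun h : ℝ ↦ h ^ (n + 2)) =o[𝓝 0] fun h ↦ h := by
        simpa using Asymptotics.isLittleO_pow_pow (𝕜 := ℝ) (show 1 < n + 2 by omega)
      exact (h1.pow (n + 2)).trans_isLittleO h2
    simpa using h
  · rw [max_eq_left hs.le]
    have h : (fun s : ℝ ↦ max s 0 ^ (n + 2)) =ᶠ[𝓝 s] fun s ↦ s ^ (n + 2) := by
      filter_upwards [Ioi_mem_nhds hs] with x hx
      rw [max_eq_left (le_of_lt (mem_Ioi.1 hx))]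
    simpa using (hasDerivAt_pow (n + 2) s).congr_of_eventuallyEq h

/-- The truncated paraboloid `(t² - ‖y - z‖²)₊`. -/
def paraboloid (z : E3) (t : ℝ) (y : E3) : ℝ := max (t ^ 2 - ‖y - z‖ ^ 2) 0

theorem paraboloid_nonneg (z : E3) (t : ℝ) (y : E3) : 0 ≤ paraboloid z t y := le_max_right _ _

theorem paraboloid_le (z : E3) (t : ℝ) (y : E3) : paraboloid z t y ≤ t ^ 2 :=
  max_le (by nlinarith [sq_nonneg ‖y - z‖]) (sq_nonneg t)

theorem paraboloid_eq_zero {z : E3} {t : ℝ} {y : E3} (ht : 0 ≤ t) (hy : y ∉ ball z t) :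
    paraboloid z t y = 0 := by
  rw [mem_ball, dist_eq_norm, not_lt] at hy
  exact max_eq_right (by nlinarith)

theorem continuous_paraboloid (z : E3) (t : ℝ) : Continuous (paraboloid z t) := by
  unfold paraboloid; fun_prop

theorem hasFDerivAt_paraboloid_pow (z : E3) (t : ℝ) (n : ℕ) (y : E3) :
    HasFDerivAt (fun y ↦ paraboloid z t y ^ (n + 2))
      ((-2 * (n + 2) * paraboloid z t y ^ (n + 1)) • innerSL ℝ (y - z)) y := by
  have h1 : HasFDerivAt (fun y : E3 ↦ t ^ 2 - ‖y - z‖ ^ 2) (-((2 : ℝ) • innerSL ℝ (y - z))) y := by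
    refine (((hasFDerivAt_id y).sub_const z).norm_sq.const_sub (t ^ 2)).congr_fderiv ?_
    ext v
    simp
  have h2 := (hasDerivAt_max_zero_pow n (t ^ 2 - ‖y - z‖ ^ 2)).comp_hasFDerivAt y h1
  convert! h2 using 1
  ext v
  simp only [paraboloid, smul_apply, neg_apply, smul_eq_mul]
  ring

theorem fderiv_paraboloid_pow_single (z : E3) (t : ℝ) (n : ℕ) (y : E3) (j : Fin 3) :
    fderiv ℝ (fun y ↦ paraboloid z t y ^ (n + 2)) y (EuclideanSpace.single j 1) =
      -2 * (n + 2) * paraboloid z t y ^ (n + 1) * (y j - z j) := by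
  rw [(hasFDerivAt_paraboloid_pow z t n y).fderiv]
  simp [EuclideanSpace.inner_single_right]

theorem hasFDerivAt_coord_sub (y : E3) (z : E3) (j : Fin 3) :
    HasFDerivAt (fun y : E3 ↦ y j - z j) (EuclideanSpace.proj j : E3 →L[ℝ] ℝ) y :=
  ((EuclideanSpace.proj j : E3 →L[ℝ] ℝ).hasFDerivAt).sub_const _

/-- Integration by parts in the direction of a basis vector. -/
theorem integral_smul_pd {f : E3 → ℝ} {g : E3 → ℂ} (j : Fin 3) (hf : ContDiff ℝ 1 f)
    (hg : ContDiff ℝ 1 g) (hgs : HasCompactSupport g) :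
    ∫ x, f x • pd j g x = -∫ x, fderiv ℝ f x (EuclideanSpace.single j 1) • g x := by
  have hf' := (hf.continuous_fderiv one_ne_zero).clm_apply
    (continuous_const (y := EuclideanSpace.single j (1 : ℝ)))
  have hg' := (hg.continuous_fderiv one_ne_zero).clm_apply
    (continuous_const (y := EuclideanSpace.single j (1 : ℝ)))
  refine integral_smul_fderiv_eq_neg_fderiv_smul_of_integrable ?_ ?_ ?_
    (fun x _ ↦ hf.differentiable one_ne_zero x) (fun x _ ↦ hg.differentiable one_ne_zero x)
  · exact (hf'.smul hg.continuous).integrable_of_hasCompactSupport hgs.smul_left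
  · exact (hf.continuous.smul hg').integrable_of_hasCompactSupport
      (HasCompactSupport.smul_left (hgs.fderiv_apply ℝ _))
  · exact (hf.continuous.smul hg.continuous).integrable_of_hasCompactSupport hgs.smul_left

theorem contDiff_paraboloid_pow (z : E3) (t : ℝ) (n : ℕ) :
    ContDiff ℝ 1 (fun y ↦ paraboloid z t y ^ (n + 2)) := by
  rw [contDiff_one_iff_fderiv]
  refine ⟨fun y ↦ (hasFDerivAt_paraboloid_pow z t n y).differentiableAt, ?_⟩
  rw [funext fun y ↦ (hasFDerivAt_paraboloid_pow z t n y).fderiv]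
  have := continuous_paraboloid z t
  fun_prop

theorem contDiff_pd {g : E3 → ℂ} (hg : ContDiff ℝ 2 g) (j : Fin 3) : ContDiff ℝ 1 (pd j g) :=
  (hg.fderiv_right (m := 1) (by norm_num)).clm_apply contDiff_const

/-- Moments of `g` against powers of the truncated paraboloid. -/
def moment (g : E3 → ℂ) (z : E3) (n : ℕ) (t : ℝ) : ℂ := ∫ y, paraboloid z t y ^ n • g y

theorem integrable_moment {g : E3 → ℂ} (hg : Continuous g) (hgs : HasCompactSupport g) (z : E3)
    (n : ℕ) (t : ℝ) : Integrable fun y ↦ paraboloid z t y ^ n • g y :=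
  (((continuous_paraboloid z t).pow n).smul hg).integrable_of_hasCompactSupport hgs.smul_left

theorem integral_paraboloid_pow_three_lap {g : E3 → ℂ} (hg : ContDiff ℝ 2 g)
    (hgs : HasCompactSupport g) (z : E3) (t : ℝ) :
    ∫ y, paraboloid z t y ^ 3 • lap g y =
      24 * (t : ℂ) ^ 2 * moment g z 1 t - 42 * moment g z 2 t := by
  have hc := continuous_paraboloid z t
  have hpds (j : Fin 3) : HasCompactSupport (pd j g) := hgs.fderiv_apply ℝ _
  have hgc : ContDiff ℝ 1 g := hg.of_le (by norm_num)
  have hgi {a : E3 → ℝ} (ha : Continuous a) : Integrable fun y ↦ a y • g y :=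
    (ha.smul hg.continuous).integrable_of_hasCompactSupport hgs.smul_left
  have key (j : Fin 3) : ∫ y, paraboloid z t y ^ 3 • pd j (pd j g) y =
      ∫ y, (24 * paraboloid z t y * (y j - z j) ^ 2 - 6 * paraboloid z t y ^ 2) • g y := by
    rw [integral_smul_pd j (contDiff_paraboloid_pow z t 1) (contDiff_pd hg j) (hpds j)]
    have hfd (y : E3) : HasFDerivAt (fun y ↦ -2 * ((1 : ℕ) + 2) * paraboloid z t y ^ (1 + 1)
        * (y j - z j)) _ y :=
      (((hasFDerivAt_paraboloid_pow z t 0 y).const_mul (-2 * ((1 : ℕ) + 2))).mul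
        (hasFDerivAt_coord_sub y z j))
    have hcd : ContDiff ℝ 1 (fun y : E3 ↦ -2 * (((1 : ℕ) : ℝ) + 2) * paraboloid z t y ^ (1 + 1)
        * (y j - z j)) := by
      have := contDiff_paraboloid_pow z t 0
      have h2 : ContDiff ℝ 1 (fun y : E3 ↦ y j) := (EuclideanSpace.proj j : E3 →L[ℝ] ℝ).contDiff
      exact (contDiff_const.mul this).mul (h2.sub contDiff_const)
    simp_rw [fderiv_paraboloid_pow_single]
    rw [integral_smul_pd j hcd hgc hgs, neg_neg]
    congr 1 with y
    rw [(hfd y).fderiv]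
    congr 1
    simp [EuclideanSpace.inner_single_right]
    ring
  have hint (j : Fin 3) : Integrable fun y ↦ paraboloid z t y ^ 3 • pd j (pd j g) y := by
    refine ((hc.pow 3).smul ?_).integrable_of_hasCompactSupport
      (HasCompactSupport.smul_left ((hpds j).fderiv_apply ℝ _))
    exact ((contDiff_pd hg j).continuous_fderiv one_ne_zero).clm_apply continuous_const
  have hcoord (j : Fin 3) : Continuous fun y : E3 ↦ y j := by fun_prop
  simp only [lap, Finset.smul_sum]
  rw [integral_finsetSum _ fun j _ ↦ hint j, Finset.sum_congr rfl fun j _ ↦ key j,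
    ← integral_finsetSum _ fun j _ ↦ hgi (by fun_prop), moment, moment, ← integral_const_mul,
    ← integral_const_mul, ← integral_sub]
  · congr 1 with y
    have hn : ‖y - z‖ ^ 2 = ∑ j, (y j - z j) ^ 2 := by simp [EuclideanSpace.norm_sq_eq]
    have hp : paraboloid z t y * ‖y - z‖ ^ 2 = t ^ 2 * paraboloid z t y - paraboloid z t y ^ 2 := by
      unfold paraboloid
      rcases max_cases (t ^ 2 - ‖y - z‖ ^ 2) 0 with ⟨h, -⟩ | ⟨h, -⟩ <;> rw [h] <;> ring
    rw [← Finset.sum_smul]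
    have : ∑ j, (24 * paraboloid z t y * (y j - z j) ^ 2 - 6 * paraboloid z t y ^ 2) =
        24 * t ^ 2 * paraboloid z t y - 42 * paraboloid z t y ^ 2 := by
      rw [Finset.sum_sub_distrib, ← Finset.mul_sum, ← hn, mul_assoc, hp]
      simp
      ring
    rw [this]
    simp only [Complex.real_smul]
    push_cast
    ring
  · exact (integrable_moment hg.continuous hgs z 1 t).const_mul _
  · exact (integrable_moment hg.continuous hgs z 2 t).const_mul _

theorem moment_three_relation {g : E3 → ℂ} (hg : ContDiff ℝ 2 g) (hgs : HasCompactSupport g)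
    {z : E3} {R k : ℝ} (hh : ∀ x ∈ ball z R, lap g x + (k : ℂ) ^ 2 * g x = 0)
    {t : ℝ} (ht : 0 ≤ t) (htR : t ≤ R) :
    -(k : ℂ) ^ 2 * moment g z 3 t = 24 * (t : ℂ) ^ 2 * moment g z 1 t - 42 * moment g z 2 t := by
  rw [← integral_paraboloid_pow_three_lap hg hgs, moment, ← integral_const_mul]
  congr 1 with y
  by_cases hy : y ∈ ball z t
  · rw [eq_neg_of_add_eq_zero_left (hh y (ball_subset_ball htR hy))]
    simp only [Complex.real_smul]
    ring
  · simp [paraboloid_eq_zero ht hy]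

theorem hasDerivAt_moment_add_two {g : E3 → ℂ} (hg : Continuous g) (hgs : HasCompactSupport g)
    (z : E3) (n : ℕ) {t : ℝ} (ht : 0 < t) :
    HasDerivAt (moment g z (n + 2)) (2 * (n + 2) * t * moment g z (n + 1) t) t := by
  have hgi := hg.integrable_of_hasCompactSupport (μ := volume) hgs
  have hd (s : ℝ) (y : E3) : HasDerivAt (fun s ↦ paraboloid z s y ^ (n + 2) • g y)
      ((2 * (n + 2) * s * paraboloid z s y ^ (n + 1)) • g y) s := by
    have h1 : HasDerivAt (fun s : ℝ ↦ s ^ 2 - ‖y - z‖ ^ 2) (2 * s) s := by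
      simpa using (hasDerivAt_pow 2 s).sub_const (‖y - z‖ ^ 2)
    have h2 := ((hasDerivAt_max_zero_pow n (s ^ 2 - ‖y - z‖ ^ 2)).comp s h1).smul_const (g y)
    convert! h2 using 1
    simp only [paraboloid]
    congr 1
    ring
  have := (hasDerivAt_integral_of_dominated_loc_of_deriv_le (μ := volume)
    (F := fun s y ↦ paraboloid z s y ^ (n + 2) • g y)
    (F' := fun s y ↦ (2 * (n + 2) * s * paraboloid z s y ^ (n + 1)) • g y)
    (bound := fun y ↦ (2 * (n + 2) * (2 * t) * ((2 * t) ^ 2) ^ (n + 1)) * ‖g y‖)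
    (Ioo_mem_nhds (show 0 < t from ht) (show t < 2 * t by linarith))
    (.of_forall fun s ↦ (integrable_moment hg hgs z _ s).aestronglyMeasurable)
    (integrable_moment hg hgs z _ t)
    (by
      have := continuous_paraboloid z t
      exact Continuous.aestronglyMeasurable (by fun_prop))
    (.of_forall fun y s hs ↦ by
      rw [norm_smul, Real.norm_of_nonneg
        (by have := paraboloid_nonneg z s y; have := hs.1; positivity)]
      have h1 := paraboloid_nonneg z s y
      have h2 := hs.1
      have h3 := hs.2.le
      have h4 := (paraboloid_le z s y).trans (pow_le_pow_left₀ h2.le h3 2)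
      gcongr)
    (hgi.norm.const_mul _)
    (.of_forall fun y s _ ↦ hd s y)).2
  convert! this using 1
  rw [moment, ← integral_const_mul]
  congr 1 with y
  simp only [Complex.real_smul]
  push_cast
  ring

theorem hasDerivAt_moment_one {g : E3 → ℂ} (hg : Continuous g) (hgs : HasCompactSupport g)
    (z : E3) {t : ℝ} (ht : 0 < t) :
    HasDerivAt (moment g z 1) (2 * t * ∫ y in ball z t, g y) t := by
  have hgi := hg.integrable_of_hasCompactSupport (μ := volume) hgs
  have := (hasDerivAt_integral_of_dominated_loc_of_lip (μ := volume) (𝕜 := ℝ)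
    (F := fun s y ↦ paraboloid z s y ^ 1 • g y)
    (F' := (ball z t).indicator fun y ↦ (2 * t) • g y)
    (bound := fun y ↦ 4 * t * ‖g y‖)
    (Ioo_mem_nhds (show 0 < t from ht) (show t < 2 * t by linarith))
    (.of_forall fun s ↦ (integrable_moment hg hgs z _ s).aestronglyMeasurable)
    (integrable_moment hg hgs z _ t)
    ((Continuous.aestronglyMeasurable (by fun_prop)).indicator measurableSet_ball)
    (.of_forall fun y ↦ LipschitzOnWith.of_dist_le_mul fun a ha b hb ↦ by
      rw [dist_eq_norm, ← sub_smul, norm_smul, pow_one, pow_one, Real.coe_nnabs,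
        abs_of_nonneg (by positivity), dist_eq_norm]
      have h1 : ‖paraboloid z a y - paraboloid z b y‖ ≤ |a ^ 2 - b ^ 2| := by
        have := abs_max_sub_max_le_abs (a ^ 2 - ‖y - z‖ ^ 2) (b ^ 2 - ‖y - z‖ ^ 2) 0
        simpa [paraboloid] using this
      have h2 : |a ^ 2 - b ^ 2| ≤ 4 * t * ‖a - b‖ := by
        rw [sq_sub_sq, abs_mul, Real.norm_eq_abs]
        gcongr
        rw [abs_of_pos (add_pos ha.1 hb.1)]
        linarith [ha.2, hb.2]
      calc _ ≤ 4 * t * ‖a - b‖ * ‖g y‖ := by gcongr; exact h1.trans h2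
        _ = _ := by ring)
    (hgi.norm.const_mul _)
    (by
      have hs : ∀ᵐ y : E3, y ∉ sphere z t :=
        measure_eq_zero_iff_ae_notMem.1 (Measure.addHaar_sphere volume z t)
      filter_upwards [hs] with y hy
      simp only [mem_sphere_iff_norm] at hy
      have h1 : HasDerivAt (fun s : ℝ ↦ s ^ 2 - ‖y - z‖ ^ 2) (2 * t) t := by
        simpa using (hasDerivAt_pow 2 t).sub_const (‖y - z‖ ^ 2)
      rcases lt_or_gt_of_ne hy with h | h
      · rw [indicator_of_mem (by simpa [dist_eq_norm] using h)]
        refine (h1.smul_const (g y)).congr_of_eventuallyEq ?_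
        filter_upwards [Ioi_mem_nhds h] with s hs
        have hs : ‖y - z‖ < s := hs
        rw [pow_one, paraboloid, max_eq_left (by nlinarith [norm_nonneg (y - z)])]
      · rw [indicator_of_notMem (by simpa [dist_eq_norm] using h.le)]
        refine (hasDerivAt_const t (0 : ℂ)).congr_of_eventuallyEq ?_
        filter_upwards [Ioo_mem_nhds ht h] with s hs
        rw [paraboloid_eq_zero hs.1.le (by simpa [dist_eq_norm] using hs.2.le)]
        simp)).2
  convert! this using 1
  rw [integral_indicator measurableSet_ball, integral_smul, Complex.real_smul]
  push_cast
  ring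

theorem eq_of_hasDerivAt_zero_of_tendsto {E : ℝ → ℂ} {R r : ℝ} {L : ℂ} (hr : r ∈ Ioo 0 R)
    (hE : ∀ t ∈ Ioo 0 R, HasDerivAt E 0 t) (hL : Tendsto E (𝓝[>] 0) (𝓝 L)) : E r = L := by
  have hc : ∀ t ∈ Ioo 0 R, E t = E r := fun t ht ↦
    isOpen_Ioo.is_const_of_deriv_eq_zero isPreconnected_Ioo
      (fun x hx ↦ (hE x hx).differentiableAt.differentiableWithinAt)
      (fun x hx ↦ (hE x hx).deriv) ht hr
  refine tendsto_nhds_unique (tendsto_const_nhds.congr' ?_) hL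
  filter_upwards [Ioo_mem_nhdsGT (hr.1.trans hr.2)] with t ht
  exact (hc t ht).symm

theorem helmholtz_moment_system {A B F : ℝ → ℂ} {k R r : ℝ} {c : ℂ} (hk : k ≠ 0)
    (hr : r ∈ Ioo 0 R) (hA : ∀ t ∈ Ioo 0 R, HasDerivAt A (2 * t * F t) t)
    (hB : ∀ t ∈ Ioo 0 R, HasDerivAt B (4 * t * A t) t)
    (hF : ∀ t ∈ Ioo 0 R, 8 * (t : ℂ) ^ 2 * F t = 20 * A t - (k : ℂ) ^ 2 * B t)
    (hF0 : Tendsto (fun t : ℝ ↦ F t / (t : ℂ) ^ 3) (𝓝[>] 0) (𝓝 c))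
    (hA0 : Tendsto (fun t : ℝ ↦ A t / (t : ℂ) ^ 3) (𝓝[>] 0) (𝓝 0)) :
    F r = 3 * c / (k : ℂ) ^ 3 * (Real.sin (k * r) - k * r * Real.cos (k * r)) := by
  set M : ℝ → ℂ := fun t ↦ 3 * (F t / (t : ℂ) ^ 3) - (k : ℂ) ^ 2 / 2 * (A t / (t : ℂ) ^ 3) with hM
  set V : ℝ → ℂ := fun t ↦ M t - (k : ℂ) ^ 2 * (t : ℂ) ^ 2 * (F t / (t : ℂ) ^ 3) with hV
  set W : ℝ → ℂ := fun t ↦ t * M t with hW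
  have hk' : (k : ℂ) ≠ 0 := by exact_mod_cast hk
  have ht0 (t : ℝ) (ht : t ∈ Ioo 0 R) : (t : ℂ) ≠ 0 := by exact_mod_cast ht.1.ne'
  have hid (t : ℝ) : HasDerivAt (fun t : ℝ ↦ (t : ℂ)) 1 t := (hasDerivAt_id t).ofReal_comp
  have hF' (t : ℝ) (ht : t ∈ Ioo 0 R) : HasDerivAt F (t ^ 2 * M t) t := by
    have h0 := ht0 t ht
    have h1 := (((hA t ht).const_mul 20).sub ((hB t ht).const_mul ((k : ℂ) ^ 2))).div
      (((hid t).pow 2).const_mul 8) (by simpa using h0)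
    have h2 : F =ᶠ[𝓝 t] fun t ↦ (20 * A t - (k : ℂ) ^ 2 * B t) / (8 * (t : ℂ) ^ 2) := by
      filter_upwards [isOpen_Ioo.mem_nhds ht] with s hs
      rw [eq_div_iff (by simpa using ht0 s hs), ← hF s hs]
      ring
    refine (h1.congr_of_eventuallyEq h2).congr_deriv ?_
    simp only [Pi.sub_apply, Pi.pow_apply, ← hF t ht, hM]
    field_simp
    push_cast
    ring
  have hFd (t : ℝ) (ht : t ∈ Ioo 0 R) := (hF' t ht).div ((hid t).pow 3) (pow_ne_zero 3 (ht0 t ht))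
  have hAd (t : ℝ) (ht : t ∈ Ioo 0 R) := (hA t ht).div ((hid t).pow 3) (pow_ne_zero 3 (ht0 t ht))
  have hM' (t : ℝ) (ht : t ∈ Ioo 0 R) : HasDerivAt M (-(k : ℂ) ^ 2 * F t / (t : ℂ) ^ 2) t := by
    have h0 := ht0 t ht
    refine (((hFd t ht).const_mul 3).sub ((hAd t ht).const_mul ((k : ℂ) ^ 2 / 2))).congr_deriv ?_
    simp only [hM, Pi.pow_apply]
    field_simp
    push_cast
    ring
  have hV' (t : ℝ) (ht : t ∈ Ioo 0 R) : HasDerivAt V (-(k : ℂ) ^ 2 * W t) t := by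
    have h0 := ht0 t ht
    refine ((hM' t ht).sub ((((hid t).pow 2).const_mul ((k : ℂ) ^ 2)).mul (hFd t ht))).congr_deriv ?_
    simp only [hW, hM, Pi.pow_apply, Pi.div_apply]
    field_simp
    push_cast
    ring
  have hW' (t : ℝ) (ht : t ∈ Ioo 0 R) : HasDerivAt W (V t) t := by
    have h0 := ht0 t ht
    refine ((hid t).mul (hM' t ht)).congr_deriv ?_
    simp only [hV]
    field_simp
    ring
  have hkt (t : ℝ) : HasDerivAt (fun t : ℝ ↦ k * t) k t := by
    simpa using (hasDerivAt_id t).const_mul k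
  have hsin (t : ℝ) : HasDerivAt (fun t : ℝ ↦ (Real.sin (k * t) : ℂ))
      ((Real.cos (k * t) * k : ℝ) : ℂ) t := (hkt t).sin.ofReal_comp
  have hcos (t : ℝ) : HasDerivAt (fun t : ℝ ↦ (Real.cos (k * t) : ℂ))
      ((-Real.sin (k * t) * k : ℝ) : ℂ) t := (hkt t).cos.ofReal_comp
  have hid0 : Tendsto (fun t : ℝ ↦ (t : ℂ)) (𝓝[>] 0) (𝓝 0) :=
    ((Complex.continuous_ofReal.tendsto' 0 0 (by simp))).mono_left nhdsWithin_le_nhds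
  have hsin0 : Tendsto (fun t : ℝ ↦ (Real.sin (k * t) : ℂ)) (𝓝[>] 0) (𝓝 0) :=
    ((Continuous.tendsto' (by fun_prop) 0 0 (by simp))).mono_left nhdsWithin_le_nhds
  have hcos0 : Tendsto (fun t : ℝ ↦ (Real.cos (k * t) : ℂ)) (𝓝[>] 0) (𝓝 1) :=
    ((Continuous.tendsto' (by fun_prop) 0 1 (by simp))).mono_left nhdsWithin_le_nhds
  have hM0 : Tendsto M (𝓝[>] 0) (𝓝 (3 * c)) := by
    simpa using (hF0.const_mul 3).sub (hA0.const_mul ((k : ℂ) ^ 2 / 2))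
  have hV0 : Tendsto V (𝓝[>] 0) (𝓝 (3 * c)) := by
    simpa using hM0.sub (((hid0.pow 2).const_mul ((k : ℂ) ^ 2)).mul hF0)
  have hW0 : Tendsto W (𝓝[>] 0) (𝓝 0) := by simpa using hid0.mul hM0
  have e1 := eq_of_hasDerivAt_zero_of_tendsto (L := 3 * c) hr
    (E := fun t ↦ V t * Real.cos (k * t) + k * (W t * Real.sin (k * t)))
    (fun t ht ↦ (((hV' t ht).mul (hcos t)).add
      (((hW' t ht).mul (hsin t)).const_mul (k : ℂ))).congr_deriv (by push_cast; ring))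
    (by simpa using (hV0.mul hcos0).add ((hW0.mul hsin0).const_mul (k : ℂ)))
  have e2 := eq_of_hasDerivAt_zero_of_tendsto (L := 0) hr
    (E := fun t ↦ V t * Real.sin (k * t) - k * (W t * Real.cos (k * t)))
    (fun t ht ↦ (((hV' t ht).mul (hsin t)).sub
      (((hW' t ht).mul (hcos t)).const_mul (k : ℂ))).congr_deriv (by push_cast; ring))
    (by simpa using (hV0.mul hsin0).sub ((hW0.mul hcos0).const_mul (k : ℂ)))
  have hFr : (k : ℂ) ^ 2 * F r = W r - r * V r := by
    have h0 := ht0 r hr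
    simp only [hW, hV]
    field_simp
    ring
  have hsc : (Real.sin (k * r) : ℂ) ^ 2 + (Real.cos (k * r) : ℂ) ^ 2 = 1 := by
    exact_mod_cast Real.sin_sq_add_cos_sq (k * r)
  generalize (Real.sin (k * r) : ℂ) = s at *
  generalize (Real.cos (k * r) : ℂ) = q at *
  have hVr : V r = 3 * c * q := by linear_combination q * e1 + s * e2 - V r * hsc
  have hWr : k * W r = 3 * c * s := by linear_combination s * e1 - q * e2 - k * W r * hsc
  rw [div_mul_eq_mul_div, eq_div_iff (pow_ne_zero 3 hk')]
  linear_combination k * hFr + hWr - k * r * hVr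

theorem volume_real_ball_fin_three (z : E3) {t : ℝ} (ht : 0 ≤ t) :
    volume.real (ball z t) = t ^ 3 * (Real.pi * 4 / 3) := by
  rw [Measure.real, EuclideanSpace.volume_ball_fin_three, ENNReal.toReal_mul, ENNReal.toReal_pow,
    ENNReal.toReal_ofReal ht, ENNReal.toReal_ofReal (by positivity)]

theorem tendsto_integral_ball_div {g : E3 → ℂ} (hg : Continuous g) (z : E3) :
    Tendsto (fun t : ℝ ↦ (∫ y in ball z t, g y) / (t : ℂ) ^ 3) (𝓝[>] 0)
      (𝓝 (4 * Real.pi / 3 * g z)) := by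
  have hs : Tendsto (fun t : ℝ ↦ ball z t) (𝓝[>] 0) (𝓝 z).smallSets := by
    rw [nhds_basis_ball.smallSets.tendsto_right_iff]
    intro ε hε
    filter_upwards [Ioo_mem_nhdsGT hε] with t ht
    exact ball_subset_ball ht.2.le
  have h1 := hg.continuousAt.integral_sub_linear_isLittleO_ae (μ := volume) (x := z)
    hg.aestronglyMeasurable.stronglyMeasurableAtFilter hs (fun t ↦ t ^ 3 * (Real.pi * 4 / 3))
    (by
      filter_upwards [self_mem_nhdsWithin] with t ht
      exact volume_real_ball_fin_three z (le_of_lt ht))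
  have h2 : (fun t : ℝ ↦ t ^ 3 * (Real.pi * 4 / 3)) =O[𝓝[>] 0] fun t : ℝ ↦ (t : ℂ) ^ 3 :=
    .of_bound (Real.pi * 4 / 3) <| .of_forall fun t ↦ by
      rw [norm_mul, norm_pow, norm_pow, Complex.norm_real, mul_comm,
        Real.norm_of_nonneg (by positivity : 0 ≤ Real.pi * 4 / 3)]
  have h3 := ((h1.trans_isBigO h2).tendsto_div_nhds_zero).add_const (4 * Real.pi / 3 * g z)
  rw [zero_add] at h3
  refine h3.congr' ?_
  filter_upwards [self_mem_nhdsWithin] with t ht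
  have h0 : (t : ℂ) ≠ 0 := by exact_mod_cast (ne_of_gt ht)
  rw [Complex.real_smul]
  push_cast
  field_simp
  ring

theorem tendsto_moment_one_div {g : E3 → ℂ} (hg : Continuous g) (hgs : HasCompactSupport g)
    (z : E3) :
    Tendsto (fun t : ℝ ↦ moment g z 1 t / (t : ℂ) ^ 3) (𝓝[>] 0) (𝓝 0) := by
  obtain ⟨C, hC⟩ := hgs.exists_bound_of_continuous hg
  have hlim : Tendsto (fun t : ℝ ↦ t ^ 2 * C * (Real.pi * 4 / 3)) (𝓝[>] 0) (𝓝 0) :=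
    (Continuous.tendsto' (by fun_prop) 0 0 (by simp)).mono_left nhdsWithin_le_nhds
  refine squeeze_zero_norm' ?_ hlim
  filter_upwards [self_mem_nhdsWithin] with t (ht : 0 < t)
  have h1 : moment g z 1 t = ∫ y in ball z t, paraboloid z t y ^ 1 • g y :=
    (setIntegral_eq_integral_of_forall_compl_eq_zero fun y hy ↦ by
      simp [paraboloid_eq_zero ht.le hy]).symm
  have h2 : ‖moment g z 1 t‖ ≤ t ^ 2 * C * volume.real (ball z t) := by
    rw [h1]
    refine norm_setIntegral_le_of_norm_le_const measure_ball_lt_top fun y _ ↦ ?_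
    rw [norm_smul, pow_one, Real.norm_of_nonneg (paraboloid_nonneg z t y)]
    exact mul_le_mul (paraboloid_le z t y) (hC y) (norm_nonneg _) (sq_nonneg t)
  rw [volume_real_ball_fin_three z ht.le] at h2
  rw [norm_div, norm_pow, Complex.norm_real, Real.norm_of_nonneg ht.le,
    div_le_iff₀ (by positivity)]
  linarith

theorem moment_two_relation {g : E3 → ℂ} (hg : ContDiff ℝ 2 g) (hgs : HasCompactSupport g)
    {z : E3} {R k : ℝ} (hh : ∀ x ∈ ball z R, lap g x + (k : ℂ) ^ 2 * g x = 0)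
    {t : ℝ} (ht : t ∈ Ioo 0 R) :
    8 * (t : ℂ) ^ 2 * ∫ y in ball z t, g y =
      20 * moment g z 1 t - (k : ℂ) ^ 2 * moment g z 2 t := by
  have h0 : (t : ℂ) ≠ 0 := by exact_mod_cast ht.1.ne'
  have hid : HasDerivAt (fun t : ℝ ↦ (t : ℂ)) 1 t := (hasDerivAt_id t).ofReal_comp
  have d1 := hasDerivAt_moment_one hg.continuous hgs z ht.1
  have d2 := hasDerivAt_moment_add_two hg.continuous hgs z 0 ht.1
  have d3 := hasDerivAt_moment_add_two hg.continuous hgs z 1 ht.1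
  have hL := d3.const_mul (-(k : ℂ) ^ 2)
  have hR := (((hid.pow 2).const_mul 24).mul d1).sub (d2.const_mul 42)
  have key := hL.unique (hR.congr_of_eventuallyEq (by
    filter_upwards [isOpen_Ioo.mem_nhds ht] with s hs
    exact moment_three_relation hg hgs hh hs.1.le hs.2.le))
  simp only [Pi.pow_apply] at key
  norm_num at key
  refine mul_left_cancel₀ (mul_ne_zero (by norm_num : (6 : ℂ) ≠ 0) h0) ?_
  linear_combination -key

theorem lap_congr_nhds {f g : E3 → ℂ} {x : E3} (h : f =ᶠ[𝓝 x] g) : lap f x = lap g x := by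
  refine Finset.sum_congr rfl fun j _ ↦ ?_
  have h1 : pd j f =ᶠ[𝓝 x] pd j g := by
    filter_upwards [h.fderiv (𝕜 := ℝ)] with y hy
    rw [pd, pd, hy]
  rw [pd, pd, h1.fderiv_eq]

theorem exists_contDiff_hasCompactSupport_eqOn_ball {u : E3 → ℂ} {U : Set E3} (hU : IsOpen U)
    (hu : ContDiffOn ℝ 2 u U) {z : E3} {r : ℝ} (hr : 0 < r) (hball : closedBall z r ⊆ U) :
    ∃ R > r, ball z R ⊆ U ∧
      ∃ g : E3 → ℂ, ContDiff ℝ 2 g ∧ HasCompactSupport g ∧ EqOn g u (ball z R) := by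
  obtain ⟨δ, hδ, hδU⟩ := (isCompact_closedBall z r).exists_cthickening_subset_open hU hball
  rw [cthickening_closedBall hδ.le hr.le, add_comm] at hδU
  let χ : ContDiffBump z := ⟨r + δ / 2, r + δ, by positivity, by linarith⟩
  have hsub : tsupport χ ⊆ U := by rwa [χ.tsupport_eq]
  refine ⟨r + δ / 2, by linarith, ?_, fun y ↦ χ y • u y, ?_, χ.hasCompactSupport.smul_right, ?_⟩
  · exact (ball_subset_closedBall.trans (closedBall_subset_closedBall (by linarith))).trans hδU
  · refine contDiff_iff_contDiffAt.2 fun x ↦ ?_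
    by_cases hx : x ∈ tsupport χ
    · exact χ.contDiff.contDiffAt.smul (hu.contDiffAt (hU.mem_nhds (hsub hx)))
    · refine (contDiffAt_const (c := (0 : ℂ))).congr_of_eventuallyEq ?_
      filter_upwards [notMem_tsupport_iff_eventuallyEq.1 hx] with y hy
      simp [hy]
  · intro y hy
    simp [χ.one_of_mem_closedBall (ball_subset_closedBall hy)]

/-- Volume mean-value formula for Helmholtz solutions: if `Δu + k²u = 0` on an open set
containing the closed ball of center `z` and radius `r`, then
`∫_{B_r(z)} u = (4π/k³)(sin(kr) − kr cos(kr)) u(z)`. -/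
theorem helmholtz_volume_mean_value (k : ℝ) (hk : 0 < k) (z : E3) (r : ℝ) (hr : 0 < r)
    (u : E3 → ℂ) (U : Set E3) (hU : IsOpen U) (hball : Metric.closedBall z r ⊆ U)
    (hu : ContDiffOn ℝ 2 u U)
    (hhelm : ∀ x ∈ U, lap u x + (k : ℂ)^2 * u x = 0) :
    (∫ y in Metric.ball z r, u y)
      = ((4 * Real.pi / k^3 * (Real.sin (k*r) - k*r*Real.cos (k*r)) : ℝ) : ℂ) * u z := by
  obtain ⟨R, hR, hRU, g, hg, hgs, hgu⟩ :=
    exists_contDiff_hasCompactSupport_eqOn_ball hU hu hr hball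
  have hh : ∀ x ∈ ball z R, lap g x + (k : ℂ) ^ 2 * g x = 0 := fun x hx ↦ by
    rw [lap_congr_nhds (hgu.eventuallyEq_of_mem (isOpen_ball.mem_nhds hx)), hgu hx]
    exact hhelm x (hRU hx)
  rw [← setIntegral_congr_fun measurableSet_ball (hgu.mono (ball_subset_ball hR.le)),
    ← hgu (mem_ball_self (hr.trans hR)),
    helmholtz_moment_system (F := fun t ↦ ∫ y in ball z t, g y) hk.ne' ⟨hr, hR⟩
      (fun t ht ↦ hasDerivAt_moment_one hg.continuous hgs z ht.1)
      (fun t ht ↦ (hasDerivAt_moment_add_two hg.continuous hgs z 0 ht.1).congr_deriv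
        (by push_cast; ring))
      (fun t ht ↦ moment_two_relation hg hgs hh ht)
      (tendsto_integral_ball_div hg.continuous z) (tendsto_moment_one_div hg.continuous hgs z)]
  push_cast
  ring
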